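/- Let $\{\mathcal{F}_k\}_{0 \leq k \leq N}$ be a filtration, $\{M_k\}$ a martingale with increments $\Delta_k = M_k - M_{k-1}$ satisfying $|\Delta_k| \leq c$ and $\mathbb{E}(\Delta_k^2 \mid \mathcal{F}_{k-1}) \leq \mathbb{E}(U_k \mid \mathcal{F}_{k-1})$ for nonnegative $\mathcal{F}_N$-measurable $U_k$, and suppose $\mathbb{P}(\sum_{k=1}^N U_k > x) \leq c_1 e^{-c_2 x}$ for all $x \geq x_0$, where $x_0 \geq e^2 c^2$. Then there exist universal constants $c_3, c_4 > 0$ (independent of $N, c, c_1, c_2, x_0$ and of the distributions) such that $\mathbb{P}(M_N - M_0 \geq x) \leq c_3\{1 + c_1 + \frac{c_1}{c_2 x_0}\} \exp(-c_4 x / \sqrt{x_0})$ whenever $x \leq c_2 x_0^{3/2}$. -/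

import Mathlib

open MeasureTheory ProbabilityTheory Real

/-- Pull-out property in integrated form. -/
lemma integral_mul_condExp_of_bound {Ω : Type*} {m m₀ : MeasurableSpace Ω} {P : Measure Ω}
    [IsFiniteMeasure P] (hm : m ≤ m₀) {Y f : Ω → ℝ} {C : ℝ} (hY : StronglyMeasurable[m] Y)
    (hC : ∀ ω, |Y ω| ≤ C) (hf : Integrable f P) :
    ∫ ω, Y ω * (P[f|m]) ω ∂P = ∫ ω, Y ω * f ω ∂P := by
  have hYf : Integrable (Y * f) P :=
    hf.bdd_mul (hY.mono hm).aestronglyMeasurable (Filter.Eventually.of_forall hC)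
  rw [← integral_condExp hm (f := fun ω => Y ω * f ω)]
  exact integral_congr_ae (condExp_mul_of_stronglyMeasurable_left hY hYf hf).symm

/-- An exponential tail beyond `x₀` controls the mean excess over `x₀`. -/
lemma integral_excess_le_of_exp_tail {Ω : Type*} [MeasurableSpace Ω] {P : Measure Ω}
    [IsFiniteMeasure P] {f : Ω → ℝ} (hf : Measurable f) {c₁ c₂ x₀ : ℝ} (hc₁ : 0 < c₁)
    (hc₂ : 0 < c₂)
    (htail : ∀ x : ℝ, x₀ ≤ x → P.real {ω | x < f ω} ≤ c₁ * exp (-c₂ * x)) :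
    Integrable (fun ω => max (f ω - x₀) 0) P ∧
      ∫ ω, max (f ω - x₀) 0 ∂P ≤ c₁ / c₂ * exp (-c₂ * x₀) := by
  have hmeas : Measurable fun ω => max (f ω - x₀) 0 := (hf.sub_const _).max measurable_const
  have hnn : ∀ ω, 0 ≤ max (f ω - x₀) 0 := fun ω => le_max_right _ _
  have hint : IntegrableOn (fun t => c₁ * exp (-c₂ * x₀) * exp (-c₂ * t)) (Set.Ioi 0) :=
    (integrableOn_exp_mul_Ioi (neg_lt_zero.2 hc₂) 0).const_mul _
  have hlin : ∫⁻ ω, ENNReal.ofReal (max (f ω - x₀) 0) ∂P ≤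
      ENNReal.ofReal (c₁ / c₂ * exp (-c₂ * x₀)) := by
    rw [lintegral_eq_lintegral_meas_lt P (Filter.Eventually.of_forall hnn) hmeas.aemeasurable]
    calc ∫⁻ t in Set.Ioi 0, P {ω | t < max (f ω - x₀) 0}
        ≤ ∫⁻ t in Set.Ioi 0, ENNReal.ofReal (c₁ * exp (-c₂ * x₀) * exp (-c₂ * t)) := by
          refine setLIntegral_mono' measurableSet_Ioi fun t ht => ?_
          rw [← ofReal_measureReal]
          refine ENNReal.ofReal_le_ofReal ?_
          have ht' : (0 : ℝ) < t := ht
          have hset : {ω | t < max (f ω - x₀) 0} = {ω | x₀ + t < f ω} := by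
            ext ω
            simp only [Set.mem_ofPred_eq, lt_max_iff]
            constructor
            · rintro (h | h) <;> linarith
            · intro h; left; linarith
          rw [hset, mul_assoc, ← Real.exp_add, ← mul_add]
          exact htail _ (by linarith)
      _ = ENNReal.ofReal (∫ t in Set.Ioi 0, c₁ * exp (-c₂ * x₀) * exp (-c₂ * t)) :=
          (ofReal_integral_eq_lintegral_ofReal hint
            (Filter.Eventually.of_forall fun t => by positivity)).symm
      _ = ENNReal.ofReal (c₁ / c₂ * exp (-c₂ * x₀)) := by
          rw [integral_const_mul, integral_exp_mul_Ioi (neg_lt_zero.2 hc₂)]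
          congr 1
          simp only [mul_zero, Real.exp_zero]
          field_simp
  have hI : Integrable (fun ω => max (f ω - x₀) 0) P := by
    refine ⟨hmeas.aestronglyMeasurable, ?_⟩
    rw [hasFiniteIntegral_iff_ofReal (Filter.Eventually.of_forall hnn)]
    exact hlin.trans_lt ENNReal.ofReal_lt_top
  refine ⟨hI, ?_⟩
  rw [integral_eq_lintegral_of_nonneg_ae (Filter.Eventually.of_forall hnn)
    hmeas.aestronglyMeasurable]
  exact ENNReal.toReal_le_of_le_ofReal (by positivity) hlin

/-- Freedman-type exponential bound: compensating the exponential of a martingale with bounded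
increments by its predictable quadratic variation keeps the mean below one. -/
lemma Martingale.integral_exp_sub_predictable_le_one {Ω : Type*} {mΩ : MeasurableSpace Ω}
    {P : Measure Ω} [IsProbabilityMeasure P] {N : ℕ} {ℱ : Filtration ℕ mΩ} {M v : ℕ → Ω → ℝ}
    {c l : ℝ} (hl : 0 ≤ l) (hlc : l * c ≤ 1) (hM : Martingale M ℱ P)
    (hbd : ∀ k < N, ∀ ω, |M (k + 1) ω - M k ω| ≤ c)
    (hvm : ∀ k < N, StronglyMeasurable[ℱ k] (v k)) (hv0 : ∀ k < N, ∀ ω, 0 ≤ v k ω)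
    (hv : ∀ k < N, P[fun ω => (M (k + 1) ω - M k ω) ^ 2|ℱ k] =ᵐ[P] v k) {n : ℕ} (hn : n ≤ N) :
    Integrable (fun ω => exp (l * (M n ω - M 0 ω) - l ^ 2 * ∑ k ∈ Finset.range n, v k ω)) P ∧
    ∫ ω, exp (l * (M n ω - M 0 ω) - l ^ 2 * ∑ k ∈ Finset.range n, v k ω) ∂P ≤ 1 := by
  have hMm : ∀ k n, k ≤ n → StronglyMeasurable[ℱ n] (M k) := fun k n h =>
    (hM.stronglyMeasurable k).mono (ℱ.mono h)
  have hVm : ∀ n ≤ N, ∀ j ≤ n + 1, j ≤ N →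
      StronglyMeasurable[ℱ n] fun ω => ∑ k ∈ Finset.range j, v k ω := by
    intro n hn j hj hjN
    refine Finset.stronglyMeasurable_fun_sum _ fun k hk => ?_
    rw [Finset.mem_range] at hk
    exact (hvm k (by omega)).mono (ℱ.mono (by omega))
  have hVnn : ∀ n ≤ N, ∀ ω, 0 ≤ ∑ k ∈ Finset.range n, v k ω := fun n hn ω =>
    Finset.sum_nonneg fun k hk => hv0 k (by rw [Finset.mem_range] at hk; omega) ω
  have hdev : ∀ n ≤ N, ∀ ω, M n ω - M 0 ω ≤ n * c := by
    intro n hn ω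
    induction n with
    | zero => simp
    | succ n ih =>
      have h1 := ih (by omega)
      have h2 := (abs_le.1 (hbd n (by omega) ω)).2
      push_cast
      linarith
  have hexp : ∀ n ≤ N, ∀ j ≤ N, ∀ ω,
      |exp (l * (M n ω - M 0 ω) - l ^ 2 * ∑ k ∈ Finset.range j, v k ω)| ≤
        exp (l * (n * c)) := by
    intro n hn j hj ω
    rw [abs_of_pos (Real.exp_pos _), Real.exp_le_exp]
    have h1 := mul_le_mul_of_nonneg_left (hdev n hn ω) hl
    have h2 := mul_nonneg (sq_nonneg l) (hVnn j hj ω)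
    linarith
  have hmeas : ∀ n ≤ N, ∀ j ≤ n + 1, j ≤ N → StronglyMeasurable[ℱ n]
      fun ω => exp (l * (M n ω - M 0 ω) - l ^ 2 * ∑ k ∈ Finset.range j, v k ω) := by
    intro n hn j hj hjN
    exact Real.continuous_exp.comp_stronglyMeasurable
      ((((hMm n n le_rfl).sub (hMm 0 n (Nat.zero_le _))).const_mul l).sub
        ((hVm n hn j hj hjN).const_mul (l ^ 2)))
  have hint : ∀ n ≤ N, ∀ j ≤ n + 1, j ≤ N → Integrable
      (fun ω => exp (l * (M n ω - M 0 ω) - l ^ 2 * ∑ k ∈ Finset.range j, v k ω)) P := by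
    intro n hn j hj hjN
    exact Integrable.of_bound ((hmeas n hn j hj hjN).mono (ℱ.le n)).aestronglyMeasurable _
      (Filter.Eventually.of_forall (hexp n hn j hjN))
  refine ⟨hint n hn n (by omega) hn, ?_⟩
  induction n with
  | zero => simp
  | succ n ih =>
    refine le_trans ?_ (ih (by omega))
    have hnN : n < N := hn
    set Y : Ω → ℝ :=
      fun ω => exp (l * (M n ω - M 0 ω) - l ^ 2 * ∑ k ∈ Finset.range (n + 1), v k ω) with hY
    set d : Ω → ℝ := fun ω => M (n + 1) ω - M n ω with hd
    have hYm : StronglyMeasurable[ℱ n] Y := hmeas n hnN.le (n + 1) le_rfl hn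
    have hYi : Integrable Y P := hint n hnN.le (n + 1) le_rfl hn
    have hYb : ∀ ω, |Y ω| ≤ exp (l * (n * c)) := hexp n hnN.le (n + 1) hn
    have hdi : Integrable d P := (hM.integrable _).sub (hM.integrable _)
    have hd2i : Integrable (fun ω => d ω ^ 2) P := by
      refine Integrable.of_bound (hdi.aestronglyMeasurable.pow 2) (c ^ 2)
        (Filter.Eventually.of_forall fun ω => ?_)
      rw [Real.norm_eq_abs, abs_pow]
      exact pow_le_pow_left₀ (abs_nonneg _) (hbd n hnN ω) 2
    have hvi : Integrable (v n) P := integrable_condExp.congr (hv n hnN)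
    have hmul : ∀ {g : Ω → ℝ}, Integrable g P → Integrable (fun ω => Y ω * g ω) P := fun hg =>
      hg.bdd_mul hYi.aestronglyMeasurable (Filter.Eventually.of_forall hYb)
    have hYd : ∫ ω, Y ω * d ω ∂P = 0 := by
      rw [← integral_mul_condExp_of_bound (ℱ.le n) hYm hYb hdi]
      refine integral_eq_zero_of_ae ?_
      have h1 : P[d|ℱ n] =ᵐ[P] P[M (n + 1)|ℱ n] - P[M n|ℱ n] :=
        condExp_sub (hM.integrable _) (hM.integrable _) _
      filter_upwards [h1, hM.condExp_ae_eq (Nat.le_succ n), hM.condExp_ae_eq (le_refl n)]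
        with ω h1 h2 h3
      simp [h1, h2, h3]
    have hYd2 : ∫ ω, Y ω * d ω ^ 2 ∂P = ∫ ω, Y ω * v n ω ∂P := by
      rw [← integral_mul_condExp_of_bound (ℱ.le n) hYm hYb hd2i]
      refine integral_congr_ae ?_
      filter_upwards [hv n hnN] with ω h
      rw [h]
    calc ∫ ω, exp (l * (M (n + 1) ω - M 0 ω) - l ^ 2 * ∑ k ∈ Finset.range (n + 1), v k ω) ∂P
        ≤ ∫ ω, (Y ω + l * (Y ω * d ω) + l ^ 2 * (Y ω * d ω ^ 2)) ∂P := by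
          refine integral_mono (hint (n + 1) hn (n + 1) (by omega) hn)
            ((hYi.add ((hmul hdi).const_mul l)).add ((hmul hd2i).const_mul _)) fun ω => ?_
          have hab : |l * d ω| ≤ 1 := by
            rw [abs_mul, abs_of_nonneg hl]
            exact (mul_le_mul_of_nonneg_left (hbd n hnN ω) hl).trans hlc
          have h1 := (abs_le.1 (Real.abs_exp_sub_one_sub_id_le hab)).2
          have h2 : exp (l * (M (n + 1) ω - M 0 ω) -
              l ^ 2 * ∑ k ∈ Finset.range (n + 1), v k ω) = Y ω * exp (l * d ω) := by
            rw [hY, ← Real.exp_add]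
            congr 1
            simp only [hd]
            ring
          have h3 := mul_le_mul_of_nonneg_left h1 (Real.exp_pos
            (l * (M n ω - M 0 ω) - l ^ 2 * ∑ k ∈ Finset.range (n + 1), v k ω)).le
          simp only [h2]
          simp only [hY] at h3 ⊢
          nlinarith [h3]
      _ = ∫ ω, (Y ω + l ^ 2 * (Y ω * v n ω)) ∂P := by
          have h1 : Integrable (fun ω => Y ω + l * (Y ω * d ω)) P :=
            hYi.add ((hmul hdi).const_mul l)
          rw [integral_add h1 ((hmul hd2i).const_mul _),
            integral_add hYi ((hmul hdi).const_mul l), integral_add hYi ((hmul hvi).const_mul _),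
            integral_const_mul, integral_const_mul, integral_const_mul, hYd, hYd2]
          ring
      _ ≤ _ := by
          refine integral_mono (hYi.add ((hmul hvi).const_mul _))
            (hint n hnN.le n (by omega) hnN.le) fun ω => ?_
          have h1 := Real.add_one_le_exp (l ^ 2 * v n ω)
          have h2 : exp (l * (M n ω - M 0 ω) - l ^ 2 * ∑ k ∈ Finset.range n, v k ω) =
              Y ω * exp (l ^ 2 * v n ω) := by
            rw [hY, ← Real.exp_add, Finset.sum_range_succ]
            congr 1
            ring
          have h3 := mul_le_mul_of_nonneg_left h1 (Real.exp_pos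
            (l * (M n ω - M 0 ω) - l ^ 2 * ∑ k ∈ Finset.range (n + 1), v k ω)).le
          simp only [h2]
          simp only [hY] at h3 ⊢
          nlinarith [h3]

/-- Exponential moment of a truncated predictable sum dominated, in conditional mean, by a
sum `∑ U k` which need not be adapted. -/
lemma integral_exp_truncated_predictable_le {Ω : Type*} {mΩ : MeasurableSpace Ω}
    {P : Measure Ω} [IsProbabilityMeasure P] {N : ℕ} {ℱ : Filtration ℕ mΩ} {v U : ℕ → Ω → ℝ}
    {a t : ℝ} (ha : 0 ≤ a) (ht : 0 ≤ t)
    (hvm : ∀ k < N, StronglyMeasurable[ℱ k] (v k)) (hv0 : ∀ k < N, ∀ ω, 0 ≤ v k ω)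
    (hvi : ∀ k < N, Integrable (v k) P)
    (hU0 : ∀ k < N, ∀ ω, 0 ≤ U k ω) (hUi : ∀ k < N, Integrable (U k) P)
    (hvU : ∀ k < N, v k ≤ᵐ[P] P[U k|ℱ k]) :
    Integrable (fun ω => exp (a * min (∑ k ∈ Finset.range N, v k ω) t)) P ∧
    ∫ ω, exp (a * min (∑ k ∈ Finset.range N, v k ω) t) ∂P ≤ 1 + a *
      ∫ ω, exp (a * min (∑ k ∈ Finset.range N, v k ω) t) * ∑ k ∈ Finset.range N, U k ω ∂P := by
  set W : ℕ → Ω → ℝ := fun n ω => exp (a * min (∑ k ∈ Finset.range n, v k ω) t) with hW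
  have hWm : ∀ n < N, StronglyMeasurable[ℱ n] (W (n + 1)) := by
    intro n hn
    have hcont : Continuous fun s : ℝ => exp (a * min s t) := by fun_prop
    refine hcont.comp_stronglyMeasurable ?_
    refine Finset.stronglyMeasurable_fun_sum _ fun k hk => ?_
    rw [Finset.mem_range] at hk
    exact (hvm k (by omega)).mono (ℱ.mono (by omega))
  have hWb : ∀ n ω, |W n ω| ≤ exp (a * t) := fun n ω => by
    rw [abs_of_pos (Real.exp_pos _), Real.exp_le_exp]
    exact mul_le_mul_of_nonneg_left (min_le_right _ _) ha
  have hWmN : ∀ n ≤ N, AEStronglyMeasurable (W n) P := by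
    intro n hn
    rcases n with _ | n
    · simpa [hW] using aestronglyMeasurable_const
    · exact ((hWm n hn).mono (ℱ.le n)).aestronglyMeasurable
  have hWi : ∀ n ≤ N, Integrable (W n) P := fun n hn =>
    Integrable.of_bound (hWmN n hn) _ (Filter.Eventually.of_forall (hWb n))
  have hWg : ∀ n ≤ N, ∀ {g : Ω → ℝ}, Integrable g P → Integrable (fun ω => W n ω * g ω) P :=
    fun n hn g hg => hg.bdd_mul (hWmN n hn) (Filter.Eventually.of_forall (hWb n))
  have hmono : ∀ n ≤ N, ∀ j ≤ n, ∀ ω, W j ω ≤ W n ω := by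
    intro n hn j hj ω
    rw [hW, Real.exp_le_exp]
    refine mul_le_mul_of_nonneg_left (min_le_min_right _ ?_) ha
    refine Finset.sum_le_sum_of_subset_of_nonneg (Finset.range_mono hj) fun k hk _ => ?_
    exact hv0 k (by rw [Finset.mem_range] at hk; omega) ω
  have hstep : ∀ n < N,
      ∫ ω, W (n + 1) ω ∂P ≤ ∫ ω, W n ω ∂P + a * ∫ ω, W N ω * U n ω ∂P := by
    intro n hn
    have h1 : ∫ ω, W (n + 1) ω ∂P ≤ ∫ ω, (W n ω + a * (W (n + 1) ω * v n ω)) ∂P := by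
      refine integral_mono (hWi _ hn)
        ((hWi n hn.le).add ((hWg _ hn (hvi n hn)).const_mul a)) fun ω => ?_
      set x := min (∑ k ∈ Finset.range n, v k ω) t with hx
      set y := min (∑ k ∈ Finset.range (n + 1), v k ω) t with hy
      have hxy : y ≤ x + v n ω := by
        have := hv0 n hn ω
        rw [hx, hy, Finset.sum_range_succ, min_add]
        exact min_le_min_left _ (by linarith)
      have h2 := Real.add_one_le_exp (a * x - a * y)
      have h3 : exp (a * x) = exp (a * y) * exp (a * x - a * y) := by
        rw [← Real.exp_add]; congr 1; ring
      have h4 : a * y ≤ a * x + a * v n ω := by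
        nlinarith
      have h5 := mul_le_mul_of_nonneg_left
        (show 1 - a * v n ω ≤ exp (a * x - a * y) by linarith) (Real.exp_pos (a * y)).le
      change exp (a * y) ≤ exp (a * x) + a * (exp (a * y) * v n ω)
      rw [h3]
      nlinarith [h5]
    have h2 : ∫ ω, W (n + 1) ω * v n ω ∂P ≤ ∫ ω, W N ω * U n ω ∂P := by
      calc ∫ ω, W (n + 1) ω * v n ω ∂P
          ≤ ∫ ω, W (n + 1) ω * (P[U n|ℱ n]) ω ∂P := by
            refine integral_mono_ae (hWg _ hn (hvi n hn)) (hWg _ hn integrable_condExp) ?_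
            filter_upwards [hvU n hn] with ω h
            exact mul_le_mul_of_nonneg_left h (Real.exp_pos _).le
        _ = ∫ ω, W (n + 1) ω * U n ω ∂P :=
            integral_mul_condExp_of_bound (ℱ.le n) (hWm n hn) (hWb _) (hUi n hn)
        _ ≤ _ := integral_mono (hWg _ hn (hUi n hn)) (hWg N le_rfl (hUi n hn)) fun ω =>
            mul_le_mul_of_nonneg_right (hmono N le_rfl _ hn ω) (hU0 n hn ω)
    rw [integral_add (hWi n hn.le) ((hWg _ hn (hvi n hn)).const_mul a),
      integral_const_mul] at h1
    linarith [mul_le_mul_of_nonneg_left h2 ha]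
  have hall : ∀ n ≤ N,
      ∫ ω, W n ω ∂P ≤ 1 + a * ∑ k ∈ Finset.range n, ∫ ω, W N ω * U k ω ∂P := by
    intro n hn
    induction n with
    | zero => simp [hW, min_eq_left ht]
    | succ n ih =>
      rw [Finset.sum_range_succ, mul_add]
      linarith [ih (by omega), hstep n hn]
  refine ⟨hWi N le_rfl, (hall N le_rfl).trans_eq ?_⟩
  rw [← integral_finsetSum _ fun k hk => hWg N le_rfl (hUi k (Finset.mem_range.1 hk))]
  simp only [Finset.mul_sum, hW]

/-- Kesten's concentration inequality for martingales with bounded increments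
and conditional variances dominated by a random sum with exponential tails. -/
theorem kesten_martingale_concentration :
    ∃ c₃ > (0 : ℝ), ∃ c₄ > (0 : ℝ),
      ∀ (Ω : Type) (_mΩ : MeasurableSpace Ω) (P : Measure Ω), IsProbabilityMeasure P →
      ∀ (N : ℕ) (ℱ : Filtration ℕ _mΩ) (M U : ℕ → Ω → ℝ) (c c₁ c₂ x₀ : ℝ),
        0 < c → 0 < c₁ → 0 < c₂ →
        Real.exp 2 * c ^ 2 ≤ x₀ →
        Martingale M ℱ P →
        (∀ k, 1 ≤ k → k ≤ N → ∀ ω, |M k ω - M (k - 1) ω| ≤ c) →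
        (∀ k, 1 ≤ k → k ≤ N → ∀ ω, 0 ≤ U k ω) →
        (∀ k, 1 ≤ k → k ≤ N → StronglyMeasurable[ℱ N] (U k)) →
        (∀ k, 1 ≤ k → k ≤ N → ∀ᵐ ω ∂P,
          (P[fun ω' => (M k ω' - M (k - 1) ω') ^ 2|ℱ (k - 1)]) ω ≤ (P[U k|ℱ (k - 1)]) ω) →
        (∀ x : ℝ, x₀ ≤ x →
          (P {ω | x < ∑ k ∈ Finset.Icc 1 N, U k ω}).toReal ≤ c₁ * Real.exp (-c₂ * x)) →
        ∀ x : ℝ, x ≤ c₂ * x₀ ^ ((3 : ℝ) / 2) →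
          (P {ω | x ≤ M N ω - M 0 ω}).toReal ≤
            c₃ * (1 + c₁ + c₁ / (c₂ * x₀)) * Real.exp (-c₄ * x / Real.sqrt x₀) := by
  refine ⟨3, by norm_num, 1 / 4, by norm_num, ?_⟩
  intro Ω mΩ P hP N ℱ M U c c₁ c₂ x₀ hc hc₁ hc₂ hx₀ hM hbd hU0 hUm hMU htail x hx
  have hcx : c ^ 2 ≤ x₀ := by
    refine le_trans ?_ hx₀
    nlinarith [Real.add_one_le_exp 2, sq_nonneg c]
  have hx₀pos : 0 < x₀ := lt_of_lt_of_le (by positivity) hcx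
  obtain ⟨s, hs, hss⟩ : ∃ s : ℝ, 0 < s ∧ s ^ 2 = x₀ :=
    ⟨√x₀, Real.sqrt_pos.2 hx₀pos, Real.sq_sqrt hx₀pos.le⟩
  have hsqrt : √x₀ = s := by rw [← hss, Real.sqrt_sq hs.le]
  have hpow : x₀ ^ ((3 : ℝ) / 2) = s ^ 3 := by
    rw [← hss, ← Real.rpow_natCast, ← Real.rpow_mul hs.le, ← Real.rpow_natCast]
    norm_num
  rw [hpow] at hx
  rw [hsqrt]
  have hconst : 0 < c₁ / (c₂ * x₀) := by positivity
  rcases le_or_gt x 0 with hx0 | hx0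
  · have h1 : 1 ≤ exp (-(1 / 4) * x / s) :=
      Real.one_le_exp (div_nonneg (by linarith) hs.le)
    have h2 : (P {ω | x ≤ M N ω - M 0 ω}).toReal ≤ 1 := measureReal_le_one
    nlinarith
  have hcs : c ≤ s := by
    rw [← hss] at hcx
    exact (abs_le_of_sq_le_sq' hcx hs.le).2
  have hsumU : ∀ ω, ∑ k ∈ Finset.Icc 1 N, U k ω = ∑ k ∈ Finset.range N, U (k + 1) ω := fun ω => by
    rw [Finset.range_eq_Ico, Finset.sum_Ico_add' (fun k => U k ω) 0 N 1]
    rfl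
  simp only [hsumU] at htail
  have hbd' : ∀ k < N, ∀ ω, |M (k + 1) ω - M k ω| ≤ c := fun k hk =>
    hbd (k + 1) (by omega) hk
  have hU0' : ∀ k < N, ∀ ω, 0 ≤ U (k + 1) ω := fun k hk => hU0 (k + 1) (by omega) hk
  have hUmeas : ∀ k < N, Measurable (U (k + 1)) := fun k hk =>
    ((hUm (k + 1) (by omega) hk).mono (ℱ.le N)).measurable
  have hSm : Measurable fun ω => ∑ k ∈ Finset.range N, U (k + 1) ω :=
    Finset.measurable_fun_sum _ fun k hk => hUmeas k (Finset.mem_range.1 hk)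
  obtain ⟨hRi, hR⟩ := integral_excess_le_of_exp_tail (P := P) hSm hc₁ hc₂ htail
  set S : Ω → ℝ := fun ω => ∑ k ∈ Finset.range N, U (k + 1) ω with hS
  set R : Ω → ℝ := fun ω => max (S ω - x₀) 0 with hRdef
  have hSR : ∀ ω, S ω ≤ x₀ + R ω := fun ω => by
    have := le_max_left (S ω - x₀) 0
    simp only [hRdef]; linarith
  have hRi' : Integrable R P := hRi
  have hSnn : ∀ ω, 0 ≤ S ω := fun ω =>
    Finset.sum_nonneg fun k hk => hU0' k (Finset.mem_range.1 hk) ω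
  have hSi : Integrable S P := by
    refine ((integrable_const x₀).add hRi').mono' hSm.aestronglyMeasurable
      (Filter.Eventually.of_forall fun ω => ?_)
    rw [Real.norm_eq_abs, abs_of_nonneg (hSnn ω)]
    exact hSR ω
  have hUi : ∀ k < N, Integrable (U (k + 1)) P := fun k hk => by
    refine hSi.mono' (hUmeas k hk).aestronglyMeasurable (Filter.Eventually.of_forall fun ω => ?_)
    rw [Real.norm_eq_abs, abs_of_nonneg (hU0' k hk ω)]
    exact Finset.single_le_sum (f := fun k => U (k + 1) ω)
      (fun k hk => hU0' k (Finset.mem_range.1 hk) ω) (Finset.mem_range.2 hk)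
  set v : ℕ → Ω → ℝ := fun k ω => max ((P[fun ω => (M (k + 1) ω - M k ω) ^ 2|ℱ k]) ω) 0 with hvdef
  have hvm : ∀ k < N, StronglyMeasurable[ℱ k] (v k) := fun k _ =>
    (by fun_prop : Continuous fun y : ℝ => max y 0).comp_stronglyMeasurable
      stronglyMeasurable_condExp
  have hv0 : ∀ k < N, ∀ ω, 0 ≤ v k ω := fun k _ ω => le_max_right _ _
  have hv : ∀ k < N, P[fun ω => (M (k + 1) ω - M k ω) ^ 2|ℱ k] =ᵐ[P] v k := fun k _ => by
    have h : 0 ≤ᵐ[P] P[fun ω => (M (k + 1) ω - M k ω) ^ 2|ℱ k] :=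
      condExp_nonneg (Filter.Eventually.of_forall fun ω => sq_nonneg _)
    filter_upwards [h] with ω h
    exact (max_eq_left h).symm
  have hvi : ∀ k < N, Integrable (v k) P := fun k hk => integrable_condExp.congr (hv k hk)
  have hvU : ∀ k < N, v k ≤ᵐ[P] P[U (k + 1)|ℱ k] := fun k hk => by
    filter_upwards [hv k hk, hMU (k + 1) (by omega) hk] with ω h1 h2
    rw [← h1]
    exact h2
  set V : Ω → ℝ := fun ω => ∑ k ∈ Finset.range N, v k ω with hV
  obtain ⟨hZi, hZ⟩ := Martingale.integral_exp_sub_predictable_le_one (l := 1 / (2 * s))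
    (by positivity) (by rw [div_mul_eq_mul_div, div_le_one (by positivity)]; linarith)
    hM hbd' hvm hv0 hv le_rfl
  obtain ⟨hWi, hW⟩ := integral_exp_truncated_predictable_le (a := 1 / (2 * s ^ 2)) (t := x * s)
    (by positivity) (by positivity) hvm hv0 hvi hU0' hUi hvU
  set W : Ω → ℝ := fun ω => exp (1 / (2 * s ^ 2) * min (V ω) (x * s)) with hWdef
  set Z : Ω → ℝ := fun ω => exp (1 / (2 * s) * (M N ω - M 0 ω) - (1 / (2 * s)) ^ 2 * V ω) with hZdef
  have hat : 1 / (2 * s ^ 2) * (x * s) = x / (2 * s) := by field_simp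
  have hWb : ∀ ω, W ω ≤ exp (x / (2 * s)) := fun ω => by
    rw [← hat, Real.exp_le_exp]
    exact mul_le_mul_of_nonneg_left (min_le_right _ _) (by positivity)
  have hWS : ∫ ω, W ω * S ω ∂P ≤ s ^ 2 * ∫ ω, W ω ∂P + exp (x / (2 * s)) * ∫ ω, R ω ∂P := by
    rw [← integral_const_mul, ← integral_const_mul, ← integral_add (hWi.const_mul _)
      (hRi'.const_mul _)]
    refine integral_mono (hSi.bdd_mul (c := exp (x / (2 * s))) hWi.aestronglyMeasurable
      (Filter.Eventually.of_forall fun ω => ?_))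
      ((hWi.const_mul _).add (hRi'.const_mul _)) fun ω => ?_
    · rw [Real.norm_eq_abs, abs_of_pos (Real.exp_pos _)]
      exact hWb ω
    · have h1 := mul_le_mul_of_nonneg_left (hSR ω) (Real.exp_pos
        (1 / (2 * s ^ 2) * min (V ω) (x * s))).le
      have h2 := mul_le_mul_of_nonneg_right (hWb ω) (le_max_right (S ω - x₀) 0)
      simp only [hss]
      simp only [hWdef, hRdef, hss] at h1 h2 ⊢
      linarith
  have hxs : x / (2 * s) + -c₂ * x₀ ≤ 0 := by
    have : x / (2 * s) ≤ c₂ * s ^ 2 := by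
      rw [div_le_iff₀ (by positivity)]
      nlinarith [mul_pos hc₂ (pow_pos hs 3)]
    rw [← hss]; linarith
  have hER : exp (x / (2 * s)) * ∫ ω, R ω ∂P ≤ c₁ / c₂ := by
    calc exp (x / (2 * s)) * ∫ ω, R ω ∂P
        ≤ exp (x / (2 * s)) * (c₁ / c₂ * exp (-c₂ * x₀)) :=
          mul_le_mul_of_nonneg_left hR (Real.exp_pos _).le
      _ = c₁ / c₂ * exp (x / (2 * s) + -c₂ * x₀) := by rw [Real.exp_add]; ring
      _ ≤ c₁ / c₂ * 1 := mul_le_mul_of_nonneg_left (Real.exp_le_one_iff.2 hxs) (by positivity)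
      _ = c₁ / c₂ := mul_one _
  have hEW : ∫ ω, W ω ∂P ≤ 2 + c₁ / (c₂ * x₀) := by
    have h1 : 1 / (2 * s ^ 2) * ∫ ω, W ω * S ω ∂P ≤
        1 / (2 * s ^ 2) * (s ^ 2 * ∫ ω, W ω ∂P + c₁ / c₂) :=
      mul_le_mul_of_nonneg_left (by linarith) (by positivity)
    have h2 : 1 / (2 * s ^ 2) * (s ^ 2 * ∫ ω, W ω ∂P + c₁ / c₂) =
        (∫ ω, W ω ∂P) / 2 + c₁ / (c₂ * x₀) / 2 := by
      rw [← hss]; field_simp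
    linarith
  have hPV : P.real {ω | exp (x / (2 * s)) ≤ W ω} ≤
      (2 + c₁ / (c₂ * x₀)) * exp (-(1 / 4) * x / s) := by
    have h1 := (mul_meas_ge_le_integral_of_nonneg (μ := P)
      (Filter.Eventually.of_forall fun ω => (Real.exp_pos _).le) hWi (exp (x / (2 * s)))).trans hEW
    have h2 : 1 ≤ exp (-(1 / 4) * x / s) * exp (x / (2 * s)) := by
      rw [← Real.exp_add]
      refine Real.one_le_exp ?_
      have : -(1 / 4) * x / s + x / (2 * s) = x / (4 * s) := by field_simp; ring
      rw [this]; positivity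
    calc P.real {ω | exp (x / (2 * s)) ≤ W ω}
        ≤ exp (-(1 / 4) * x / s) * exp (x / (2 * s)) * P.real {ω | exp (x / (2 * s)) ≤ W ω} :=
          le_mul_of_one_le_left measureReal_nonneg h2
      _ ≤ exp (-(1 / 4) * x / s) * (2 + c₁ / (c₂ * x₀)) := by
          rw [mul_assoc]
          exact mul_le_mul_of_nonneg_left h1 (Real.exp_pos _).le
      _ = _ := mul_comm _ _
  have hPZ : P.real {ω | exp (x / (4 * s)) ≤ Z ω} ≤ exp (-(1 / 4) * x / s) := by
    have h1 := (mul_meas_ge_le_integral_of_nonneg (μ := P)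
      (Filter.Eventually.of_forall fun ω => (Real.exp_pos _).le) hZi (exp (x / (4 * s)))).trans hZ
    have h2 : exp (-(1 / 4) * x / s) = (exp (x / (4 * s)))⁻¹ := by
      rw [← Real.exp_neg]; congr 1; field_simp
    rw [h2, ← one_div, le_div_iff₀' (Real.exp_pos _)]
    exact h1
  have hsub : {ω | x ≤ M N ω - M 0 ω} ⊆
      {ω | exp (x / (4 * s)) ≤ Z ω} ∪ {ω | exp (x / (2 * s)) ≤ W ω} := by
    intro ω hω
    have hω' : x ≤ M N ω - M 0 ω := hω
    rcases le_total (x * s) (V ω) with h | h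
    · right
      change exp (x / (2 * s)) ≤ exp (1 / (2 * s ^ 2) * min (V ω) (x * s))
      rw [min_eq_right h, hat]
    · left
      change exp (x / (4 * s)) ≤
        exp (1 / (2 * s) * (M N ω - M 0 ω) - (1 / (2 * s)) ^ 2 * V ω)
      rw [Real.exp_le_exp]
      have h1 : x / (4 * s) = 1 / (2 * s) * x - (1 / (2 * s)) ^ 2 * (x * s) := by
        field_simp; ring
      rw [h1]
      gcongr
  calc (P {ω | x ≤ M N ω - M 0 ω}).toReal
      ≤ P.real ({ω | exp (x / (4 * s)) ≤ Z ω} ∪ {ω | exp (x / (2 * s)) ≤ W ω}) :=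
        measureReal_mono hsub
    _ ≤ P.real {ω | exp (x / (4 * s)) ≤ Z ω} + P.real {ω | exp (x / (2 * s)) ≤ W ω} :=
        measureReal_union_le _ _
    _ ≤ (3 + c₁ / (c₂ * x₀)) * exp (-(1 / 4) * x / s) := by linarith
    _ ≤ 3 * (1 + c₁ + c₁ / (c₂ * x₀)) * exp (-(1 / 4) * x / s) :=
        mul_le_mul_of_nonneg_right (by linarith) (Real.exp_pos _).le
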